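/- Let μ be a DNS satisfaction function and let I be a PB instance with c_max < b, where Greedy_μ and MES_μ break ties by the same fixed linear order on projects. Let p_1, …, p_g be the projects chosen by Greedy_μ in order of selection and assume c({p_1,…,p_g}) ≥ b − c_max. Let ĝ be the least index with c({p_1,…,p_ĝ}) ≥ b − c_max, and define the truncated greedy welfare W = uw_μ({p_1,…,p_{ĝ−1}}) + |N_{p_ĝ}|·μ(p_ĝ)·(b − c_max − c({p_1,…,p_{ĝ−1}}))/c(p_ĝ). Let P_M be the outcome of MES_μ completed by Greedy_μ. Then uw_μ(P_M) ≥ (2·√(c_min/b) − (c_max + c_min)/b) · (b/(b − c_max)) · W. -/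

import Mathlib

open Finset
open scoped Classical

noncomputable section

/-- A participatory budgeting (PB) instance. -/
structure PB (π ν : Type) where
  projs : Finset π
  voters : Finset ν
  approves : ν → Finset π
  cost : π → ℝ
  budget : ℝ
  projs_nonempty : projs.Nonempty
  budget_pos : 0 < budget
  cost_pos : ∀ p ∈ projs, 0 < cost p
  cost_le_budget : ∀ p ∈ projs, cost p ≤ budget
  approves_subset : ∀ i ∈ voters, approves i ⊆ projs

/-- A satisfaction function assigns a positive value to each positive cost. -/
def IsSat (μ : ℝ → ℝ) : Prop := ∀ t : ℝ, 0 < t → 0 < μ t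

/-- A DNS function: weakly increasing, with weakly decreasing satisfaction per unit cost. -/
def IsDNS (μ : ℝ → ℝ) : Prop :=
  IsSat μ ∧ (∀ s t : ℝ, 0 < s → s ≤ t → μ s ≤ μ t) ∧
    (∀ s t : ℝ, 0 < s → s ≤ t → μ t / t ≤ μ s / s)

namespace PB

variable {π ν : Type}

/-- Supporters of a project. -/
def supp (I : PB π ν) (p : π) : Finset ν := I.voters.filter (fun i => p ∈ I.approves i)

/-- Total cost of a set of projects. -/
def costOf (I : PB π ν) (S : Finset π) : ℝ := ∑ p ∈ S, I.cost p

/-- A feasible outcome. -/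
def feasibleSet (I : PB π ν) (S : Finset π) : Prop := S ⊆ I.projs ∧ I.costOf S ≤ I.budget

/-- Minimum project cost. -/
def cmin (I : PB π ν) : ℝ := I.projs.inf' I.projs_nonempty I.cost

/-- Maximum project cost. -/
def cmax (I : PB π ν) : ℝ := I.projs.sup' I.projs_nonempty I.cost

/-- Utilitarian welfare of a set of projects. -/
def uw (I : PB π ν) (μ : ℝ → ℝ) (S : Finset π) : ℝ :=
  ∑ p ∈ S, ((I.supp p).card : ℝ) * μ (I.cost p)

/-- The value ("bang per buck") of a project. -/
def projVal (I : PB π ν) (μ : ℝ → ℝ) (p : π) : ℝ :=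
  ((I.supp p).card : ℝ) * μ (I.cost p) / I.cost p

/-- Satisfaction of voter `i` from an outcome. -/
def satOf (I : PB π ν) (μ : ℝ → ℝ) (i : ν) (S : Finset π) : ℝ :=
  ∑ p ∈ S ∩ I.approves i, μ (I.cost p)

/-- Minimum satisfaction of a project in the instance. -/
def muMin (I : PB π ν) (μ : ℝ → ℝ) : ℝ :=
  I.projs.inf' I.projs_nonempty (fun p => μ (I.cost p))

/-- Maximum satisfaction of a project in the instance. -/
def muMax (I : PB π ν) (μ : ℝ → ℝ) : ℝ :=
  I.projs.sup' I.projs_nonempty (fun p => μ (I.cost p))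

/-- The maximal utilitarian welfare over feasible outcomes. -/
def maxUW (I : PB π ν) (μ : ℝ → ℝ) : ℝ :=
  (I.projs.powerset.filter (fun S => I.costOf S ≤ I.budget)).sup'
    ⟨∅, Finset.mem_filter.mpr ⟨Finset.empty_mem_powerset _,
      by simpa [PB.costOf] using I.budget_pos.le⟩⟩
    (I.uw μ)

/-- A group `N'` is `T`-cohesive. -/
def cohesive (I : PB π ν) (N' : Finset ν) (T : Finset π) : Prop :=
  N' ⊆ I.voters ∧ T ⊆ I.projs ∧ (∀ i ∈ N', T ⊆ I.approves i) ∧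
    I.costOf T ≤ ((N'.card : ℝ) / (I.voters.card : ℝ)) * I.budget

/-- Extended justified representation up to one project w.r.t. `μ`. -/
def EJR1 (I : PB π ν) (μ : ℝ → ℝ) (W : Finset π) : Prop :=
  ∀ N' T, I.cohesive N' T →
    T ⊆ W ∨ ∃ i ∈ N', ∃ p ∈ I.approves i, p ∉ W ∧
      I.satOf μ i W + μ (I.cost p) > I.satOf μ i T

/-- Pick the element of maximal `f`-value, breaking ties by the linear order. -/
def pickMax [LinearOrder π] (f : π → ℝ) (S : Finset π) (h : S.Nonempty) : π :=
  (S.filter (fun p => ∀ q ∈ S, f q ≤ f p)).min' (by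
    obtain ⟨p, hp, hm⟩ := S.exists_max_image f h
    exact ⟨p, Finset.mem_filter.mpr ⟨hp, hm⟩⟩)

/-- Pick the element of minimal `f`-value, breaking ties by the linear order. -/
def pickMin [LinearOrder π] (f : π → ℝ) (S : Finset π) (h : S.Nonempty) : π :=
  (S.filter (fun p => ∀ q ∈ S, f p ≤ f q)).min' (by
    obtain ⟨p, hp, hm⟩ := S.exists_min_image f h
    exact ⟨p, Finset.mem_filter.mpr ⟨hp, hm⟩⟩)

section Greedy

variable [LinearOrder π]

/-- One choice of the greedy rule: among the unchosen affordable projects, the one of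
maximum value (ties broken by the linear order); `none` if no project is affordable. -/
def greedyStep (I : PB π ν) (μ : ℝ → ℝ) (rem : Finset π) (budg : ℝ) : Option π :=
  if h : (rem.filter (fun p => I.cost p ≤ budg)).Nonempty then
    some (pickMax (I.projVal μ) (rem.filter (fun p => I.cost p ≤ budg)) h)
  else none

/-- The (ordered) list of projects chosen by the greedy rule, with fuel. -/
def greedyAux (I : PB π ν) (μ : ℝ → ℝ) : ℕ → Finset π → ℝ → List π
  | 0, _, _ => []
  | (k+1), rem, budg =>
    match I.greedyStep μ rem budg with
    | none => []
    | some p => p :: greedyAux I μ k (rem.erase p) (budg - I.cost p)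

/-- The projects chosen by `Greedy_μ`, in order of selection. -/
def greedySeq (I : PB π ν) (μ : ℝ → ℝ) : List π :=
  greedyAux I μ I.projs.card I.projs I.budget

/-- The outcome of the greedy rule started from a set `rem` of unchosen projects
with remaining budget `budg`. -/
def greedyFrom (I : PB π ν) (μ : ℝ → ℝ) (rem : Finset π) (budg : ℝ) : Finset π :=
  (greedyAux I μ rem.card rem budg).toFinset

/-- The outcome of `Greedy_μ`. -/
def greedy (I : PB π ν) (μ : ℝ → ℝ) : Finset π := (I.greedySeq μ).toFinset

/-- The state (unchosen projects, remaining budget) of `Greedy_μ` after `k` stages. -/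
def greedyStateAux (I : PB π ν) (μ : ℝ → ℝ) : ℕ → Finset π × ℝ
  | 0 => (I.projs, I.budget)
  | (k+1) =>
    match I.greedyStep μ (greedyStateAux I μ k).1 (greedyStateAux I μ k).2 with
    | none => greedyStateAux I μ k
    | some p => ((greedyStateAux I μ k).1.erase p, (greedyStateAux I μ k).2 - I.cost p)

/-- The project chosen by `Greedy_μ` at stage `k+1` (i.e. after `k` stages), if any. -/
def greedyChoice (I : PB π ν) (μ : ℝ → ℝ) (k : ℕ) : Option π :=
  I.greedyStep μ (I.greedyStateAux μ k).1 (I.greedyStateAux μ k).2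

end Greedy

section MES

variable [LinearOrder π]

/-- The set of values `ρ ≥ 0` at which project `p` can be bought given voter budgets `bud`. -/
def rhoSet (I : PB π ν) (μ : ℝ → ℝ) (bud : ν → ℝ) (p : π) : Set ℝ :=
  {ρ : ℝ | 0 ≤ ρ ∧ ∑ i ∈ I.supp p, min (bud i) (ρ * μ (I.cost p)) = I.cost p}

/-- `ρ(p)`: the least `ρ ≥ 0` at which `p` can be bought (junk value if none exists). -/
def rho (I : PB π ν) (μ : ℝ → ℝ) (bud : ν → ℝ) (p : π) : ℝ := sInf (I.rhoSet μ bud p)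

/-- One choice of MES: among the unchosen projects with `ρ(p) < ∞`, one minimizing `ρ(p)`
(ties broken by the linear order); `none` if no project can be bought. -/
def mesStep (I : PB π ν) (μ : ℝ → ℝ) (rem : Finset π) (bud : ν → ℝ) : Option π :=
  if h : (rem.filter (fun p => (I.rhoSet μ bud p).Nonempty)).Nonempty then
    some (pickMin (I.rho μ bud) (rem.filter (fun p => (I.rhoSet μ bud p).Nonempty)) h)
  else none

/-- Voter budgets after the supporters of `p` pay for it. -/
def mesPay (I : PB π ν) (μ : ℝ → ℝ) (bud : ν → ℝ) (p : π) : ν → ℝ :=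
  fun i => if i ∈ I.supp p then bud i - min (bud i) (I.rho μ bud p * μ (I.cost p)) else bud i

/-- The state (unchosen projects, voter budgets) of `MES_μ` after `k` stages. -/
def mesStateAux (I : PB π ν) (μ : ℝ → ℝ) : ℕ → Finset π × (ν → ℝ)
  | 0 => (I.projs, fun _ => I.budget / (I.voters.card : ℝ))
  | (k+1) =>
    match I.mesStep μ (mesStateAux I μ k).1 (mesStateAux I μ k).2 with
    | none => mesStateAux I μ k
    | some p => ((mesStateAux I μ k).1.erase p, I.mesPay μ (mesStateAux I μ k).2 p)

/-- The project chosen by `MES_μ` at stage `k+1` (i.e. after `k` stages), if any. -/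
def mesChoice (I : PB π ν) (μ : ℝ → ℝ) (k : ℕ) : Option π :=
  I.mesStep μ (I.mesStateAux μ k).1 (I.mesStateAux μ k).2

/-- The final state of `MES_μ`. -/
def mesFinal (I : PB π ν) (μ : ℝ → ℝ) : Finset π × (ν → ℝ) :=
  I.mesStateAux μ I.projs.card

/-- The outcome of `MES_μ`. -/
def mesOutcome (I : PB π ν) (μ : ℝ → ℝ) : Finset π := I.projs \ (I.mesFinal μ).1

/-- The outcome of `MES_μ` completed by `Greedy_μ`: run MES, then greedy on the unchosen
projects with the remaining total budget. -/
def completedMES (I : PB π ν) (μ : ℝ → ℝ) : Finset π :=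
  I.mesOutcome μ ∪
    I.greedyFrom μ (I.mesFinal μ).1 (I.budget - I.costOf (I.mesOutcome μ))

/-- Voter `i` is budget-limited for project `p` after `k` stages of `MES_μ`:
`p` is unchosen and approved by `i`, affordable from the total remaining budget,
but an equal split of its cost exceeds `i`'s personal budget. -/
def budgetLimitedAt (I : PB π ν) (μ : ℝ → ℝ) (k : ℕ) (i : ν) (p : π) : Prop :=
  i ∈ I.voters ∧ p ∈ (I.mesStateAux μ k).1 ∧ p ∈ I.approves i ∧
    I.cost p ≤ ∑ j ∈ I.voters, (I.mesStateAux μ k).2 j ∧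
    (I.mesStateAux μ k).2 i < I.cost p / ((I.supp p).card : ℝ)

end MES

/-- Total cost of a list of projects. -/
def listCost (I : PB π ν) (L : List π) : ℝ := (L.map I.cost).sum

/-- Total utilitarian welfare of a list of projects. -/
def listUW (I : PB π ν) (μ : ℝ → ℝ) (L : List π) : ℝ :=
  (L.map (fun p => ((I.supp p).card : ℝ) * μ (I.cost p))).sum

end PB

namespace PB

variable {π ν : Type} (I : PB π ν) {μ : ℝ → ℝ}

theorem cmin_pos : 0 < I.cmin :=
  (Finset.lt_inf'_iff _).2 fun p hp => I.cost_pos p hp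

theorem cmin_le_cost {p : π} (hp : p ∈ I.projs) : I.cmin ≤ I.cost p :=
  Finset.inf'_le _ hp

theorem cost_le_cmax {p : π} (hp : p ∈ I.projs) : I.cost p ≤ I.cmax :=
  Finset.le_sup' _ hp

theorem supp_subset_voters (p : π) : I.supp p ⊆ I.voters :=
  Finset.filter_subset _ _

theorem projVal_nonneg (hμ : IsSat μ) {p : π} (hp : p ∈ I.projs) : 0 ≤ I.projVal μ p :=
  div_nonneg (mul_nonneg (Nat.cast_nonneg _) (hμ _ (I.cost_pos p hp)).le) (I.cost_pos p hp).le

theorem cost_mul_projVal {p : π} (hp : p ∈ I.projs) :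
    I.cost p * I.projVal μ p = ((I.supp p).card : ℝ) * μ (I.cost p) :=
  mul_div_cancel₀ _ (I.cost_pos p hp).ne'

theorem card_supp_mul_pos (hμ : IsSat μ) {p : π} (hp : p ∈ I.projs) (h : (I.supp p).Nonempty) :
    0 < ((I.supp p).card : ℝ) * μ (I.cost p) :=
  mul_pos (Nat.cast_pos.2 h.card_pos) (hμ _ (I.cost_pos p hp))

theorem uw_eq_sum {S : Finset π} (hS : S ⊆ I.projs) :
    I.uw μ S = ∑ p ∈ S, I.cost p * I.projVal μ p :=
  Finset.sum_congr rfl fun _ hp => (I.cost_mul_projVal (hS hp)).symm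

theorem uw_mono (hμ : IsSat μ) {S T : Finset π} (hST : S ⊆ T) (hT : T ⊆ I.projs) :
    I.uw μ S ≤ I.uw μ T :=
  Finset.sum_le_sum_of_subset_of_nonneg hST fun p hp _ =>
    mul_nonneg (Nat.cast_nonneg _) (hμ _ (I.cost_pos p (hT hp))).le

theorem uw_nonneg (hμ : IsSat μ) {S : Finset π} (hS : S ⊆ I.projs) : 0 ≤ I.uw μ S :=
  Finset.sum_nonneg fun p hp => mul_nonneg (Nat.cast_nonneg _) (hμ _ (I.cost_pos p (hS hp))).le

theorem costOf_mono {S T : Finset π} (hST : S ⊆ T) (hT : T ⊆ I.projs) :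
    I.costOf S ≤ I.costOf T :=
  Finset.sum_le_sum_of_subset_of_nonneg hST fun p hp _ => (I.cost_pos p (hT hp)).le

section Pick

variable [LinearOrder π] {f : π → ℝ} {S : Finset π}

theorem pickMax_mem (h : S.Nonempty) : pickMax f S h ∈ S :=
  (Finset.mem_filter.1 (Finset.min'_mem _ _)).1

theorem le_pickMax (h : S.Nonempty) {q : π} (hq : q ∈ S) : f q ≤ f (pickMax f S h) :=
  (Finset.mem_filter.1 (Finset.min'_mem (S.filter (fun p => ∀ q ∈ S, f q ≤ f p)) _)).2 q hq

theorem pickMin_mem (h : S.Nonempty) : pickMin f S h ∈ S :=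
  (Finset.mem_filter.1 (Finset.min'_mem _ _)).1

theorem pickMin_le (h : S.Nonempty) {q : π} (hq : q ∈ S) : f (pickMin f S h) ≤ f q :=
  (Finset.mem_filter.1 (Finset.min'_mem (S.filter (fun p => ∀ q ∈ S, f p ≤ f q)) _)).2 q hq

end Pick

section Greedy

variable [LinearOrder π]

theorem greedyStep_eq_none {rem : Finset π} {x : ℝ} (h : I.greedyStep μ rem x = none)
    {p : π} (hp : p ∈ rem) : x < I.cost p := by
  unfold greedyStep at h
  split_ifs at h with hne
  by_contra! hle
  exact hne ⟨p, Finset.mem_filter.2 ⟨hp, hle⟩⟩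

theorem greedyStep_mem {rem : Finset π} {x : ℝ} {q : π} (h : I.greedyStep μ rem x = some q) :
    q ∈ rem := by
  unfold greedyStep at h
  split_ifs at h with hne
  rw [← Option.some.inj h]
  exact (Finset.mem_filter.1 (pickMax_mem hne)).1

theorem le_of_greedyStep {rem : Finset π} {x : ℝ} {q : π} (h : I.greedyStep μ rem x = some q)
    {p : π} (hp : p ∈ rem) (hpx : I.cost p ≤ x) : I.projVal μ p ≤ I.projVal μ q := by
  unfold greedyStep at h
  split_ifs at h with hne
  rw [← Option.some.inj h]
  exact le_pickMax hne (Finset.mem_filter.2 ⟨hp, hpx⟩)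

theorem mem_of_mem_greedyAux {k : ℕ} {rem : Finset π} {x : ℝ} {p : π}
    (hp : p ∈ I.greedyAux μ k rem x) : p ∈ rem := by
  induction k generalizing rem x with
  | zero => simp [greedyAux] at hp
  | succ k ih =>
    unfold greedyAux at hp
    split at hp
    · simp at hp
    · rename_i q hq
      rcases List.mem_cons.1 hp with rfl | hp
      · exact I.greedyStep_mem hq
      · exact Finset.mem_of_mem_erase (ih hp)

theorem nodup_greedyAux (k : ℕ) (rem : Finset π) (x : ℝ) : (I.greedyAux μ k rem x).Nodup := by
  induction k generalizing rem x with
  | zero => simp [greedyAux]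
  | succ k ih =>
    unfold greedyAux
    split
    · simp
    · rename_i q hq
      exact List.nodup_cons.2
        ⟨fun h => Finset.notMem_erase q rem (I.mem_of_mem_greedyAux h), ih _ _⟩

/-- When greedy skips a project, the chosen projects of at least its value leave too little
budget for it. -/
theorem lt_sum_greedyAux {k : ℕ} {rem : Finset π} {x : ℝ} (hrem : rem ⊆ I.projs)
    (hk : rem.card ≤ k) {p : π} (hp : p ∈ rem) (hpn : p ∉ I.greedyAux μ k rem x) :
    x - I.cost p <
      (((I.greedyAux μ k rem x).filter fun q => I.projVal μ p ≤ I.projVal μ q).map I.cost).sum := by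
  induction k generalizing rem x with
  | zero => exact absurd (Finset.card_pos.2 ⟨p, hp⟩) (by omega)
  | succ k ih =>
    have hnn : ∀ l : List π, (∀ q ∈ l, q ∈ rem) → 0 ≤ (l.map I.cost).sum := fun l hl =>
      List.sum_nonneg (by
        intro y hy
        obtain ⟨q, hq, rfl⟩ := List.mem_map.1 hy
        exact (I.cost_pos q (hrem (hl q hq))).le)
    have hnn' := hnn ((I.greedyAux μ (k + 1) rem x).filter fun q => I.projVal μ p ≤ I.projVal μ q)
      fun q hq => I.mem_of_mem_greedyAux (List.mem_of_mem_filter hq)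
    by_cases hx : x < I.cost p
    · linarith
    push Not at hx
    unfold greedyAux at hpn ⊢
    split
    · rename_i h
      exact absurd (I.greedyStep_eq_none h hp) (not_lt.2 hx)
    · rename_i q hq
      rw [hq] at hpn
      simp only [List.mem_cons, not_or] at hpn
      have hv := I.le_of_greedyStep hq hp hx
      have := ih ((Finset.erase_subset q rem).trans hrem)
        (by rw [Finset.card_erase_of_mem (I.greedyStep_mem hq)]; omega)
        (Finset.mem_erase.2 ⟨hpn.1, hp⟩) hpn.2
      rw [List.filter_cons_of_pos (by simpa using hv)]
      simp only [List.map_cons, List.sum_cons]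
      linarith

theorem greedyFrom_subset (rem : Finset π) (x : ℝ) : I.greedyFrom μ rem x ⊆ rem := fun _ hp =>
  I.mem_of_mem_greedyAux (List.mem_toFinset.1 hp)

theorem lt_costOf_greedyFrom {rem : Finset π} {x : ℝ} (hrem : rem ⊆ I.projs) {p : π}
    (hp : p ∈ rem) (hpn : p ∉ I.greedyFrom μ rem x) :
    x - I.cost p <
      I.costOf ((I.greedyFrom μ rem x).filter fun q => I.projVal μ p ≤ I.projVal μ q) := by
  have h := I.lt_sum_greedyAux hrem le_rfl hp (fun h => hpn (List.mem_toFinset.2 h))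
  rw [← List.sum_toFinset _ ((I.nodup_greedyAux _ _ _).filter _)] at h
  refine h.trans_eq (Finset.sum_congr ?_ fun _ _ => rfl)
  ext q
  simp [greedyFrom]

/-- Linear programming duality bound for a fractionally truncated list of projects. -/
theorem listUW_add_le {L : List π} {q : π} (hL : (q :: L).Nodup)
    (hLP : ∀ p ∈ q :: L, p ∈ I.projs) {B θ : ℝ} (hlt : I.listCost L ≤ B)
    (hge : B ≤ I.listCost L + I.cost q) :
    I.listUW μ L + ((I.supp q).card : ℝ) * μ (I.cost q) * (B - I.listCost L) / I.cost q ≤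
      θ * B + ∑ p ∈ I.projs, I.cost p * max (I.projVal μ p - θ) 0 := by
  have hq : q ∈ I.projs := hLP q (by simp)
  have hc := I.cost_pos q hq
  obtain ⟨hqL, hLn⟩ := List.nodup_cons.1 hL
  have hsub : insert q L.toFinset ⊆ I.projs := by
    intro p hp
    exact hLP p (by simpa using hp)
  have hW : I.listUW μ L = ∑ p ∈ L.toFinset, I.cost p * I.projVal μ p := by
    rw [listUW, ← List.sum_toFinset _ hLn]
    exact Finset.sum_congr rfl fun p hp => (I.cost_mul_projVal (hsub (by simp_all))).symm
  have hC : I.listCost L = ∑ p ∈ L.toFinset, I.cost p := (List.sum_toFinset _ hLn).symm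
  have hsum := Finset.sum_le_sum_of_subset_of_nonneg hsub
    (f := fun p => I.cost p * max (I.projVal μ p - θ) 0)
    fun p hp _ => mul_nonneg (I.cost_pos p hp).le (le_max_right _ _)
  rw [Finset.sum_insert (by simpa using hqL)] at hsum
  have h1 : ∑ p ∈ L.toFinset, I.cost p * (I.projVal μ p - θ) ≤
      ∑ p ∈ L.toFinset, I.cost p * max (I.projVal μ p - θ) 0 :=
    Finset.sum_le_sum fun p hp => mul_le_mul_of_nonneg_left (le_max_left _ _)
      (I.cost_pos p (hsub (by simp_all))).le
  simp only [mul_sub, Finset.sum_sub_distrib, ← Finset.sum_mul] at h1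
  rw [← hW, ← hC] at h1
  have h2 : (B - I.listCost L) * (I.projVal μ q - θ) ≤
      I.cost q * max (I.projVal μ q - θ) 0 := by
    rcases le_total 0 (I.projVal μ q - θ) with h0 | h0
    · exact mul_le_mul (by linarith) (le_max_left _ _) h0 hc.le
    · exact (mul_nonpos_of_nonneg_of_nonpos (by linarith) h0).trans
        (mul_nonneg hc.le (le_max_right _ _))
  have h3 : ((I.supp q).card : ℝ) * μ (I.cost q) * (B - I.listCost L) / I.cost q =
      (B - I.listCost L) * I.projVal μ q := by
    rw [projVal]; ring
  rw [h3]
  linarith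

end Greedy

theorem rho_nonneg (bud : ν → ℝ) (p : π) : 0 ≤ I.rho μ bud p :=
  Real.sInf_nonneg fun _ h => h.1

theorem rho_mem {bud : ν → ℝ} {p : π} (h : (I.rhoSet μ bud p).Nonempty) :
    I.rho μ bud p ∈ I.rhoSet μ bud p := by
  refine IsClosed.csInf_mem ?_ h ⟨0, fun _ h => h.1⟩
  exact (isClosed_le continuous_const continuous_id).inter
    (isClosed_eq (by fun_prop) continuous_const)

theorem rho_le {bud : ν → ℝ} {p : π} {ρ : ℝ} (h : ρ ∈ I.rhoSet μ bud p) : I.rho μ bud p ≤ ρ :=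
  csInf_le ⟨0, fun _ h => h.1⟩ h

theorem one_le_mul_projVal {bud : ν → ℝ} {p : π} {ρ : ℝ} (hp : p ∈ I.projs)
    (h : ρ ∈ I.rhoSet μ bud p) : 1 ≤ ρ * I.projVal μ p := by
  have h1 : I.cost p ≤ ((I.supp p).card : ℝ) * (ρ * μ (I.cost p)) := by
    rw [← nsmul_eq_mul]
    exact h.2.symm.le.trans (Finset.sum_le_card_nsmul _ _ _ fun i _ => min_le_right _ _)
  rw [projVal, ← mul_div_assoc, le_div_iff₀ (I.cost_pos p hp)]
  linarith

theorem inv_projVal_mem_rhoSet (hμ : IsSat μ) {bud : ν → ℝ} {p : π} (hp : p ∈ I.projs)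
    (hne : (I.supp p).Nonempty) (h : ∀ i ∈ I.supp p, I.cost p / ((I.supp p).card : ℝ) ≤ bud i) :
    (I.projVal μ p)⁻¹ ∈ I.rhoSet μ bud p := by
  refine ⟨inv_nonneg.2 (I.projVal_nonneg hμ hp), ?_⟩
  have hμp := (hμ _ (I.cost_pos p hp)).ne'
  have hN : ((I.supp p).card : ℝ) ≠ 0 := Nat.cast_ne_zero.2 hne.card_pos.ne'
  have h1 : (I.projVal μ p)⁻¹ * μ (I.cost p) = I.cost p / ((I.supp p).card : ℝ) := by
    rw [projVal]
    field_simp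
  rw [h1, Finset.sum_congr rfl fun i hi => min_eq_right (h i hi), Finset.sum_const, nsmul_eq_mul,
    mul_div_cancel₀ _ hN]

section MES

variable [LinearOrder π]

theorem mesStep_spec {rem : Finset π} {bud : ν → ℝ} {q : π} (h : I.mesStep μ rem bud = some q) :
    q ∈ rem ∧ (I.rhoSet μ bud q).Nonempty ∧
      ∀ p ∈ rem, (I.rhoSet μ bud p).Nonempty → I.rho μ bud q ≤ I.rho μ bud p := by
  unfold mesStep at h
  split_ifs at h with hne
  rw [← Option.some.inj h]
  obtain ⟨h1, h2⟩ := Finset.mem_filter.1 (pickMin_mem (f := I.rho μ bud) hne)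
  exact ⟨h1, h2, fun p hp hp' => pickMin_le hne (Finset.mem_filter.2 ⟨hp, hp'⟩)⟩

theorem rhoSet_eq_empty_of_mesStep {rem : Finset π} {bud : ν → ℝ}
    (h : I.mesStep μ rem bud = none) {p : π} (hp : p ∈ rem) : ¬ (I.rhoSet μ bud p).Nonempty := by
  unfold mesStep at h
  split_ifs at h with hne
  exact fun hp' => hne ⟨p, Finset.mem_filter.2 ⟨hp, hp'⟩⟩

theorem mesStateAux_succ_of_some {k : ℕ} {q : π} (h : I.mesChoice μ k = some q) :
    I.mesStateAux μ (k + 1) =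
      ((I.mesStateAux μ k).1.erase q, I.mesPay μ (I.mesStateAux μ k).2 q) := by
  unfold mesChoice at h
  rw [mesStateAux, h]

theorem mesStateAux_succ_of_none {k : ℕ} (h : I.mesChoice μ k = none) :
    I.mesStateAux μ (k + 1) = I.mesStateAux μ k := by
  unfold mesChoice at h
  rw [mesStateAux, h]

theorem mesStateAux_fst_antitone : Antitone fun k => (I.mesStateAux μ k).1 := by
  refine antitone_nat_of_succ_le fun k => ?_
  cases h : I.mesChoice μ k with
  | none => rw [I.mesStateAux_succ_of_none h]
  | some q =>
    rw [I.mesStateAux_succ_of_some h]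
    exact Finset.erase_subset _ _

theorem mesStateAux_fst_subset (k : ℕ) : (I.mesStateAux μ k).1 ⊆ I.projs :=
  I.mesStateAux_fst_antitone (Nat.zero_le k)

theorem mesStateAux_snd_mem_Icc (hμ : IsSat μ) (k : ℕ) (i : ν) :
    (I.mesStateAux μ k).2 i ∈ Set.Icc 0 (I.budget / (I.voters.card : ℝ)) := by
  induction k with
  | zero => exact ⟨div_nonneg I.budget_pos.le (Nat.cast_nonneg _), le_rfl⟩
  | succ k ih =>
    cases h : I.mesChoice μ k with
    | none => rwa [I.mesStateAux_succ_of_none h]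
    | some q =>
      have hq := I.mesStateAux_fst_subset k (I.mesStep_spec h).1
      rw [I.mesStateAux_succ_of_some h]
      simp only [mesPay]
      split_ifs
      · have h1 := min_le_left ((I.mesStateAux μ k).2 i)
          (I.rho μ (I.mesStateAux μ k).2 q * μ (I.cost q))
        have h2 := le_min ih.1 (mul_nonneg (I.rho_nonneg (μ := μ) (I.mesStateAux μ k).2 q)
          (hμ _ (I.cost_pos q hq)).le)
        exact ⟨by linarith, by linarith [ih.2]⟩
      · exact ih

/-- Every project bought by MES has value at least `n * μ(c_min) / b`. -/
theorem le_projVal_of_mem_mesOutcome (hμ : IsDNS μ) {p : π} (hp : p ∈ I.mesOutcome μ) :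
    (I.voters.card : ℝ) * μ I.cmin / I.budget ≤ I.projVal μ p := by
  obtain ⟨hpP, hpn⟩ := Finset.mem_sdiff.1 hp
  have hex : ∀ k, p ∉ (I.mesStateAux μ k).1 →
      ∃ j, (I.rhoSet μ (I.mesStateAux μ j).2 p).Nonempty := by
    intro k
    induction k with
    | zero => exact fun h => absurd hpP h
    | succ k ih =>
      intro h
      by_cases hk : p ∈ (I.mesStateAux μ k).1
      · cases hc : I.mesChoice μ k with
        | none =>
          rw [I.mesStateAux_succ_of_none hc] at h
          exact absurd hk h
        | some q =>
          rw [I.mesStateAux_succ_of_some hc] at h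
          have hpq : p = q := by
            by_contra hne
            exact h (Finset.mem_erase.2 ⟨hne, hk⟩)
          exact ⟨k, hpq ▸ (I.mesStep_spec hc).2.1⟩
      · exact ih hk
  obtain ⟨j, ρ, hρ⟩ := hex _ hpn
  have hc := I.cost_pos p hpP
  have h1 : I.cost p ≤ ((I.supp p).card : ℝ) * (I.budget / (I.voters.card : ℝ)) := by
    rw [← nsmul_eq_mul]
    exact hρ.2.symm.le.trans (Finset.sum_le_card_nsmul _ _ _ fun i _ =>
      (min_le_left _ _).trans (I.mesStateAux_snd_mem_Icc hμ.1 j i).2)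
  have hn : (0 : ℝ) < I.voters.card := by
    rcases (Nat.cast_nonneg (α := ℝ) I.voters.card).eq_or_lt with h | h
    · rw [← h, div_zero, mul_zero] at h1
      linarith
    · exact h
  rw [← mul_div_assoc, le_div_iff₀ hn] at h1
  have h2 := hμ.2.1 _ _ I.cmin_pos (I.cmin_le_cost hpP)
  have h3 := hμ.1 _ hc
  rw [projVal, div_le_div_iff₀ I.budget_pos hc]
  calc (I.voters.card : ℝ) * μ I.cmin * I.cost p
      ≤ (I.voters.card : ℝ) * μ (I.cost p) * I.cost p := by gcongr
    _ = I.cost p * I.voters.card * μ (I.cost p) := by ring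
    _ ≤ ((I.supp p).card : ℝ) * I.budget * μ (I.cost p) := by gcongr
    _ = _ := by ring

/-- The state of a run that has bought only projects of maximum value, each paid for in equal
shares by its supporters. -/
def EqualShareState (I : PB π ν) (μ : ℝ → ℝ) (s : Finset π × (ν → ℝ)) : Prop :=
  (∀ q ∈ I.projs \ s.1, ∀ p ∈ s.1, I.projVal μ p ≤ I.projVal μ q) ∧
    ∀ i ∈ I.voters, s.2 i = I.budget / (I.voters.card : ℝ) -
      ∑ q ∈ I.projs \ s.1, if i ∈ I.supp q then I.cost q / ((I.supp q).card : ℝ) else 0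

theorem EqualShareState.step {I : PB π ν} (hμ : IsSat μ) {k : ℕ}
    (hs : I.EqualShareState μ (I.mesStateAux μ k)) {p : π} (hp : p ∈ (I.mesStateAux μ k).1)
    (hmax : ∀ q ∈ (I.mesStateAux μ k).1, I.projVal μ q ≤ I.projVal μ p)
    (hne : (I.supp p).Nonempty)
    (h : ∀ i ∈ I.supp p, I.cost p / ((I.supp p).card : ℝ) ≤ (I.mesStateAux μ k).2 i) :
    I.EqualShareState μ (I.mesStateAux μ (k + 1)) ∧
      (I.mesStateAux μ (k + 1)).1.card + 1 = (I.mesStateAux μ k).1.card := by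
  have hsub := I.mesStateAux_fst_subset (μ := μ) k
  have hmem := I.inv_projVal_mem_rhoSet hμ (hsub hp) hne h
  cases hc : I.mesChoice μ k with
  | none => exact absurd ⟨_, hmem⟩ (I.rhoSet_eq_empty_of_mesStep hc hp)
  | some q =>
    obtain ⟨hq, hqne, hqmin⟩ := I.mesStep_spec hc
    have hqP := hsub hq
    have hvp : 0 < I.projVal μ p :=
      div_pos (I.card_supp_mul_pos hμ (hsub hp) hne) (I.cost_pos p (hsub hp))
    have hρ := I.rho_mem hqne
    have hρle := (hqmin p hp ⟨_, hmem⟩).trans (I.rho_le hmem)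
    have hρge := I.one_le_mul_projVal hqP hρ
    have hvle := hmax q hq
    have hρ0 := I.rho_nonneg (μ := μ) (I.mesStateAux μ k).2 q
    have hup : I.rho μ (I.mesStateAux μ k).2 q * I.projVal μ p ≤ 1 := by
      rwa [← one_div, le_div_iff₀ hvp] at hρle
    have hρpos : 0 < I.rho μ (I.mesStateAux μ k).2 q := by
      rcases hρ0.eq_or_lt with h0 | h0
      · rw [← h0] at hρge
        linarith
      · exact h0
    have hveq : I.projVal μ q = I.projVal μ p :=
      hvle.antisymm (le_of_mul_le_mul_left (hup.trans hρge) hρpos)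
    have hρ1 : I.rho μ (I.mesStateAux μ k).2 q * I.projVal μ q = 1 :=
      le_antisymm (hveq ▸ hup) hρge
    have hcq := I.cost_pos q hqP
    have hN : ((I.supp q).card : ℝ) ≠ 0 := by
      intro h0
      rw [projVal, h0] at hρ1
      simp at hρ1
    have hshare : I.rho μ (I.mesStateAux μ k).2 q * μ (I.cost q) =
        I.cost q / ((I.supp q).card : ℝ) := by
      rw [projVal] at hρ1
      field_simp at hρ1 ⊢
      linarith
    have hpay : ∀ i ∈ I.supp q, min ((I.mesStateAux μ k).2 i)
        (I.rho μ (I.mesStateAux μ k).2 q * μ (I.cost q)) = I.cost q / ((I.supp q).card : ℝ) := by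
      refine (Finset.sum_eq_sum_iff_of_le fun i _ => (min_le_right _ _).trans_eq hshare).1 ?_
      rw [hρ.2, Finset.sum_const, nsmul_eq_mul, mul_div_cancel₀ _ hN]
    have hins : I.projs \ (I.mesStateAux μ k).1.erase q =
        insert q (I.projs \ (I.mesStateAux μ k).1) := by
      ext r
      simp only [Finset.mem_sdiff, Finset.mem_erase, Finset.mem_insert]
      by_cases hr : r = q
      · simp [hr, hqP]
      · simp [hr]
    rw [I.mesStateAux_succ_of_some hc]
    refine ⟨⟨?_, ?_⟩, Finset.card_erase_add_one hq⟩
    · rw [hins]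
      intro r hr r' hr'
      have hr'' := Finset.mem_of_mem_erase hr'
      rcases Finset.mem_insert.1 hr with rfl | hr
      · exact hveq ▸ hmax r' hr''
      · exact hs.1 r hr r' hr''
    · intro i hi
      rw [hins, Finset.sum_insert (by simp [hq])]
      simp only [mesPay]
      split_ifs with hiq
      · rw [hpay i hiq, hs.2 i hi]
        ring
      · rw [hs.2 i hi]
        ring

/-- MES buys projects of maximum value in equal shares until the unchosen projects are worthless
or some supporter of an unchosen project of maximum value cannot afford an equal share. -/
theorem exists_equalShareState (hμ : IsSat μ) :
    ∃ k ≤ I.projs.card, I.EqualShareState μ (I.mesStateAux μ k) ∧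
      ((∀ p ∈ (I.mesStateAux μ k).1, I.projVal μ p ≤ 0) ∨
        ∃ p ∈ (I.mesStateAux μ k).1,
          (∀ q ∈ (I.mesStateAux μ k).1, I.projVal μ q ≤ I.projVal μ p) ∧
          ∃ i ∈ I.supp p, (I.mesStateAux μ k).2 i < I.cost p / ((I.supp p).card : ℝ)) := by
  by_contra! hcon
  have hall : ∀ k ≤ I.projs.card, I.EqualShareState μ (I.mesStateAux μ k) ∧
      (I.mesStateAux μ k).1.card + k = I.projs.card := by
    intro k
    induction k with
    | zero =>
      intro _
      refine ⟨⟨?_, ?_⟩, rfl⟩ <;> simp [mesStateAux]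
    | succ k ih =>
      intro hk
      obtain ⟨hs, hcard⟩ := ih (by omega)
      obtain ⟨⟨r, hr, hr0⟩, hno⟩ := hcon k (by omega) hs
      obtain ⟨p, hp, hmax⟩ := Finset.exists_max_image _ (I.projVal μ) ⟨r, hr⟩
      have hne : (I.supp p).Nonempty := by
        by_contra hemp
        have h0 : I.projVal μ p = 0 := by
          simp [projVal, Finset.not_nonempty_iff_eq_empty.1 hemp]
        linarith [hmax r hr]
      obtain ⟨h1, h2⟩ := hs.step hμ hp hmax hne (hno p hp hmax)
      exact ⟨h1, by omega⟩
  obtain ⟨hs, hcard⟩ := hall _ le_rfl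
  obtain ⟨⟨r, hr, -⟩, -⟩ := hcon _ le_rfl hs
  have := Finset.card_pos.2 ⟨r, hr⟩
  omega

/-- In an equal-share state, a supporter who cannot afford an equal share of `p` witnesses that
almost all the money corresponding to the value of `p` has been spent. -/
theorem EqualShareState.lt_costOf_add {I : PB π ν} (hμ : IsDNS μ) {s : Finset π × (ν → ℝ)}
    (hs : I.EqualShareState μ s) {p : π} (hpP : p ∈ I.projs) (hp : p ∈ s.1) {i : ν}
    (hi : i ∈ I.supp p) (hlt : s.2 i < I.cost p / ((I.supp p).card : ℝ)) :
    I.projVal μ p * I.cmin / μ I.cmin * (I.budget / (I.voters.card : ℝ)) <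
      I.costOf (I.projs \ s.1) + I.cmax := by
  have hm := I.cmin_pos
  have hμm := hμ.1 _ hm
  have hKpos : 0 < I.projVal μ p * I.cmin / μ I.cmin :=
    div_pos (mul_pos (div_pos (I.card_supp_mul_pos hμ.1 hpP ⟨i, hi⟩) (I.cost_pos p hpP)) hm) hμm
  have hK : ∀ q ∈ I.projs, I.projVal μ p ≤ I.projVal μ q →
      I.projVal μ p * I.cmin / μ I.cmin ≤ ((I.supp q).card : ℝ) := by
    intro q hq hv
    have hc := I.cost_pos q hq
    have h1 := hμ.2.2 _ _ hm (I.cmin_le_cost hq)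
    rw [div_le_iff₀ hμm]
    calc I.projVal μ p * I.cmin ≤ I.projVal μ q * I.cmin := by gcongr
      _ = ((I.supp q).card : ℝ) * (μ (I.cost q) / I.cost q) * I.cmin := by
          rw [projVal, mul_div_assoc]
      _ ≤ ((I.supp q).card : ℝ) * (μ I.cmin / I.cmin) * I.cmin := by gcongr
      _ = _ := by field_simp
  have hshare : ∀ q ∈ I.projs, I.projVal μ p ≤ I.projVal μ q →
      I.projVal μ p * I.cmin / μ I.cmin * (I.cost q / ((I.supp q).card : ℝ)) ≤ I.cost q := by
    intro q hq hv
    have h1 := hK q hq hv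
    have hN := hKpos.trans_le h1
    rw [← mul_div_assoc, div_le_iff₀ hN, mul_comm]
    exact mul_le_mul_of_nonneg_left h1 (I.cost_pos q hq).le
  have hiv : i ∈ I.voters := I.supp_subset_voters p hi
  have hbud := hs.2 i hiv
  have hsum : I.projVal μ p * I.cmin / μ I.cmin * (∑ q ∈ I.projs \ s.1,
      if i ∈ I.supp q then I.cost q / ((I.supp q).card : ℝ) else 0) ≤
      I.costOf (I.projs \ s.1) := by
    rw [Finset.mul_sum]
    refine Finset.sum_le_sum fun q hq => ?_
    have hqP := (Finset.mem_sdiff.1 hq).1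
    split_ifs
    · exact hshare q hqP (hs.1 q hq p hp)
    · rw [mul_zero]
      exact (I.cost_pos q hqP).le
  have h2 := mul_lt_mul_of_pos_left (a := I.projVal μ p * I.cmin / μ I.cmin)
    (show I.budget / (I.voters.card : ℝ) < (∑ q ∈ I.projs \ s.1,
      if i ∈ I.supp q then I.cost q / ((I.supp q).card : ℝ) else 0) +
        I.cost p / ((I.supp p).card : ℝ) by linarith) hKpos
  rw [mul_add] at h2
  linarith [hshare p hpP le_rfl, I.cost_le_cmax hpP]

theorem completedMES_subset : I.completedMES μ ⊆ I.projs :=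
  Finset.union_subset Finset.sdiff_subset
    ((I.greedyFrom_subset _ _).trans (I.mesStateAux_fst_subset _))

/-- When a project is left out of completed MES, the chosen projects of value at least `θ` nearly
exhaust the budget, for every `θ` below its value and below that of all projects bought by MES. -/
theorem budget_sub_cmax_le_costOf {p : π} (hp : p ∈ I.projs) (hpn : p ∉ I.completedMES μ) {θ : ℝ}
    (hθp : θ ≤ I.projVal μ p) (hθ : ∀ q ∈ I.mesOutcome μ, θ ≤ I.projVal μ q) :
    I.budget - I.cmax ≤ I.costOf ((I.completedMES μ).filter fun q => θ ≤ I.projVal μ q) := by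
  simp only [completedMES, Finset.mem_union, not_or] at hpn
  have hpr : p ∈ (I.mesFinal μ).1 := by
    by_contra h
    exact hpn.1 (Finset.mem_sdiff.2 ⟨hp, h⟩)
  have h1 := I.lt_costOf_greedyFrom (rem := (I.mesFinal μ).1) (I.mesStateAux_fst_subset _) hpr hpn.2
  set G := I.greedyFrom μ (I.mesFinal μ).1 (I.budget - I.costOf (I.mesOutcome μ))
  set F := G.filter fun q => I.projVal μ p ≤ I.projVal μ q
  have hdisj : Disjoint (I.mesOutcome μ) F := by
    rw [Finset.disjoint_left]
    intro q hq hqF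
    exact (Finset.mem_sdiff.1 hq).2 (I.greedyFrom_subset _ _ (Finset.mem_filter.1 hqF).1)
  have h2 : I.costOf (I.mesOutcome μ ∪ F) = I.costOf (I.mesOutcome μ) + I.costOf F :=
    Finset.sum_union hdisj
  have h3 : I.costOf (I.mesOutcome μ ∪ F) ≤
      I.costOf ((I.completedMES μ).filter fun q => θ ≤ I.projVal μ q) := by
    refine I.costOf_mono ?_ ((Finset.filter_subset _ _).trans I.completedMES_subset)
    intro q hq
    rcases Finset.mem_union.1 hq with hq | hq
    · exact Finset.mem_filter.2 ⟨Finset.mem_union_left _ hq, hθ q hq⟩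
    · obtain ⟨hqG, hqv⟩ := Finset.mem_filter.1 hq
      exact Finset.mem_filter.2 ⟨Finset.mem_union_right _ hqG, hθp.trans hqv⟩
  linarith [I.cost_le_cmax hp]

/-- Completed MES either spends `b - c_max` on projects of value at least `n * μ(c_min) / b`, or
contains an optimal solution of the fractional knapsack problem with capacity `b - c_max`. -/
theorem completedMES_dichotomy (hμ : IsDNS μ) :
    I.budget - I.cmax ≤ I.costOf ((I.completedMES μ).filter fun q =>
        (I.voters.card : ℝ) * μ I.cmin / I.budget ≤ I.projVal μ q) ∨
      ∃ R ⊆ I.completedMES μ, ∃ θ, (∀ p ∈ R, θ ≤ I.projVal μ p) ∧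
        (∀ p ∈ I.projs, p ∉ R → I.projVal μ p ≤ θ) ∧
        θ * (I.budget - I.cmax - I.costOf R) ≤ 0 := by
  by_cases hne : (I.projs \ I.completedMES μ).Nonempty
  · obtain ⟨p, hp, hmax⟩ := Finset.exists_max_image _ (I.projVal μ) hne
    obtain ⟨hpP, hpn⟩ := Finset.mem_sdiff.1 hp
    rcases le_total ((I.voters.card : ℝ) * μ I.cmin / I.budget) (I.projVal μ p) with h | h
    · exact Or.inl (I.budget_sub_cmax_le_costOf hpP hpn h
        fun q hq => I.le_projVal_of_mem_mesOutcome hμ hq)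
    · refine Or.inr ⟨(I.completedMES μ).filter fun q => I.projVal μ p ≤ I.projVal μ q,
        Finset.filter_subset _ _, I.projVal μ p, fun q hq => (Finset.mem_filter.1 hq).2, ?_, ?_⟩
      · intro q hq hqn
        by_cases hqM : q ∈ I.completedMES μ
        · by_contra! hlt
          exact hqn (Finset.mem_filter.2 ⟨hqM, hlt.le⟩)
        · exact hmax q (Finset.mem_sdiff.2 ⟨hq, hqM⟩)
      · have := I.budget_sub_cmax_le_costOf hpP hpn le_rfl
          fun q hq => h.trans (I.le_projVal_of_mem_mesOutcome hμ hq)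
        exact mul_nonpos_of_nonneg_of_nonpos (I.projVal_nonneg hμ.1 hpP) (by linarith)
  · rw [Finset.not_nonempty_iff_eq_empty, Finset.sdiff_eq_empty_iff_subset] at hne
    exact Or.inr ⟨I.completedMES μ, subset_rfl, 0,
      fun p hp => I.projVal_nonneg hμ.1 (I.completedMES_subset hp),
      fun p hp hpn => absurd (hne hp) hpn, by simp⟩

end MES

theorem sum_max_projVal_sub {R : Finset π} (hR : R ⊆ I.projs) {θ : ℝ}
    (hge : ∀ p ∈ R, θ ≤ I.projVal μ p) (hle : ∀ p ∈ I.projs, p ∉ R → I.projVal μ p ≤ θ) :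
    ∑ p ∈ I.projs, I.cost p * max (I.projVal μ p - θ) 0 = I.uw μ R - θ * I.costOf R := by
  rw [← Finset.sum_subset hR fun p hp hpR => by
    rw [max_eq_right (sub_nonpos.2 (hle p hp hpR)), mul_zero], I.uw_eq_sum hR, costOf,
    Finset.mul_sum, ← Finset.sum_sub_distrib]
  refine Finset.sum_congr rfl fun p hp => ?_
  rw [max_eq_left (sub_nonneg.2 (hge p hp))]
  ring

theorem uw_add_mul_le {S Q : Finset π} (hSQ : S ⊆ Q) (hQ : Q ⊆ I.projs) {τ : ℝ}
    (hτ : ∀ p ∈ Q, τ ≤ I.projVal μ p) :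
    I.uw μ S + τ * (I.costOf Q - I.costOf S) ≤ I.uw μ Q := by
  have h : ∑ p ∈ S, I.cost p * (I.projVal μ p - τ) ≤ ∑ p ∈ Q, I.cost p * (I.projVal μ p - τ) :=
    Finset.sum_le_sum_of_subset_of_nonneg hSQ fun p hp _ =>
      mul_nonneg (I.cost_pos p (hQ hp)).le (sub_nonneg.2 (hτ p hp))
  simp only [mul_sub, Finset.sum_sub_distrib, ← Finset.sum_mul] at h
  rw [← I.uw_eq_sum hQ, ← I.uw_eq_sum (hSQ.trans hQ)] at h
  simp only [costOf]
  linarith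

end PB

theorem coeff_mul_le_one {b m M : ℝ} (hb : 0 < b) (hm : 0 ≤ m) (hMb : M < b) :
    (2 * Real.sqrt (m / b) - (M + m) / b) * (b / (b - M)) ≤ 1 := by
  have hB : 0 < b - M := by linarith
  have ha := Real.sq_sqrt (div_nonneg hm hb.le)
  set a := Real.sqrt (m / b)
  rw [← mul_div_assoc, div_le_one hB, sub_mul, div_mul_cancel₀ _ hb.ne']
  have hmb : m = a ^ 2 * b := by rw [ha]; field_simp
  rw [hmb]
  nlinarith [mul_nonneg hb.le (sq_nonneg (a - 1))]

/-- Welfare comparison after spending `s` on projects of total welfare `U` and value at least `v`,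
when the remaining projects have value at least `τ` in one outcome and at most `v` in the other. -/
theorem coeff_mul_le_of_spent {b m M s v w τ U X W : ℝ} (hb : 0 < b) (hm : 0 ≤ m) (hMb : M < b)
    (hv : 0 < v) (hw : 0 < w) (hτw : τ * w = v * (m / b)) (hbw : b * w ≤ s + M)
    (hU0 : 0 ≤ U) (hU : s * v ≤ U) (hUX : U ≤ X) (hX : U + τ * (b - M - s) ≤ X) (hW0 : 0 ≤ W)
    (hW : W ≤ U + v * (b - M - s)) :
    (2 * Real.sqrt (m / b) - (M + m) / b) * (b / (b - M)) * W ≤ X := by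
  have hB : 0 < b - M := by linarith
  have hκ1 := coeff_mul_le_one hb hm hMb
  have ha := Real.sq_sqrt (div_nonneg hm hb.le)
  have hκB : (2 * Real.sqrt (m / b) - (M + m) / b) * (b / (b - M)) * (b - M) =
      b * (2 * Real.sqrt (m / b) - m / b) - M := by
    field_simp
    ring
  set a := Real.sqrt (m / b)
  set κ := (2 * a - (M + m) / b) * (b / (b - M))
  rw [← ha] at hτw hκB
  have hκW : κ * W ≤ W := mul_le_of_le_one_left hW0 hκ1
  rcases le_total (b - M) s with hs | hs
  · nlinarith [mul_nonneg hv.le (sub_nonneg.2 hs)]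
  rcases le_total v τ with hτv | hτv
  · nlinarith [mul_nonneg (sub_nonneg.2 hτv) (sub_nonneg.2 hs)]
  rcases le_total κ 0 with hκ0 | hκ0
  · exact (mul_nonpos_of_nonpos_of_nonneg hκ0 hW0).trans (hU0.trans hUX)
  have h1 := mul_le_mul_of_nonneg_left hW hκ0
  have h2 := mul_le_mul_of_nonneg_left hU (sub_nonneg.2 hκ1)
  suffices h : 0 ≤ w * (s * (v - τ) + (b - M) * τ - v * (κ * (b - M))) by
    have := nonneg_of_mul_nonneg_right h hw
    nlinarith
  have h3 : w * (s * (v - τ) + (b - M) * τ - v * (κ * (b - M))) =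
      w * (s + M - b * w) * (v - τ) + v * b * (w - a) ^ 2 := by
    rw [hκB]
    linear_combination (b - b * w) * hτw
  rw [h3]
  have h4 := mul_nonneg (mul_nonneg hw.le (sub_nonneg.2 hbw)) (sub_nonneg.2 hτv)
  have h5 := mul_nonneg (mul_nonneg hv.le hb.le) (sq_nonneg (w - a))
  linarith

/-- Comparative guarantee of completed MES over the truncated Greedy welfare. -/
theorem mes_over_truncated_greedy {π ν : Type} [LinearOrder π] (I : PB π ν)
    (μ : ℝ → ℝ) (hDNS : IsDNS μ) (hcb : I.cmax < I.budget)
    (hcost : I.budget - I.cmax ≤ I.listCost (I.greedySeq μ))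
    (ghat : ℕ)
    (hghat : IsLeast {k : ℕ | I.budget - I.cmax ≤ I.listCost ((I.greedySeq μ).take k)} ghat)
    (pg : π) (hpg : (I.greedySeq μ)[ghat - 1]? = some pg) :
    I.uw μ (I.completedMES μ) ≥
      (2 * Real.sqrt (I.cmin / I.budget) - (I.cmax + I.cmin) / I.budget) *
        (I.budget / (I.budget - I.cmax)) *
        (I.listUW μ ((I.greedySeq μ).take (ghat - 1)) +
          ((I.supp pg).card : ℝ) * μ (I.cost pg) *
            (I.budget - I.cmax - I.listCost ((I.greedySeq μ).take (ghat - 1))) /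
              I.cost pg) := by
  obtain ⟨hμ, hinc, hdec⟩ := id hDNS
  have hb := I.budget_pos
  have hm := I.cmin_pos
  have hB : 0 < I.budget - I.cmax := sub_pos.2 hcb
  have hghat1 : 1 ≤ ghat := by
    by_contra! h0
    have h1 := hghat.1
    rw [Nat.lt_one_iff.1 h0] at h1
    simp [PB.listCost] at h1
    linarith
  have hge : I.budget - I.cmax ≤
      I.listCost ((I.greedySeq μ).take (ghat - 1)) + I.cost pg := by
    have h1 : I.budget - I.cmax ≤ I.listCost ((I.greedySeq μ).take (ghat - 1 + 1)) := by
      rw [Nat.sub_add_cancel hghat1]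
      exact hghat.1
    simpa [List.take_add_one, hpg, PB.listCost] using h1
  have hlt : I.listCost ((I.greedySeq μ).take (ghat - 1)) ≤ I.budget - I.cmax := by
    by_contra! h1
    have := hghat.2 (show ghat - 1 ∈ {k : ℕ | _} from h1.le)
    omega
  have htake : (I.greedySeq μ).take (ghat - 1 + 1) =
      (I.greedySeq μ).take (ghat - 1) ++ [pg] := by
    simp [List.take_add_one, hpg]
  set L := (I.greedySeq μ).take (ghat - 1)
  have hperm : (pg :: L).Perm ((I.greedySeq μ).take (ghat - 1 + 1)) :=
    htake ▸ (List.perm_append_singleton pg L).symm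
  have hnodup : (pg :: L).Nodup :=
    hperm.nodup_iff.2 ((I.nodup_greedyAux _ _ _).sublist (List.take_sublist _ _))
  have hLP : ∀ p ∈ pg :: L, p ∈ I.projs := fun p hp =>
    I.mem_of_mem_greedyAux (List.mem_of_mem_take (hperm.mem_iff.1 hp))
  have hdual := fun θ : ℝ => I.listUW_add_le (μ := μ) (θ := θ) hnodup hLP hlt hge
  have hW0 : 0 ≤ I.listUW μ L + ((I.supp pg).card : ℝ) * μ (I.cost pg) *
      (I.budget - I.cmax - I.listCost L) / I.cost pg := by
    have hpgP := hLP pg (by simp)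
    have hc := I.cost_pos pg hpgP
    refine add_nonneg (List.sum_nonneg ?_) (div_nonneg (mul_nonneg (mul_nonneg
      (Nat.cast_nonneg _) (hμ _ hc).le) (sub_nonneg.2 hlt)) hc.le)
    intro x hx
    obtain ⟨p, hp, rfl⟩ := List.mem_map.1 hx
    exact mul_nonneg (Nat.cast_nonneg _) (hμ _ (I.cost_pos p (hLP p (by simp [hp])))).le
  set W := I.listUW μ L + ((I.supp pg).card : ℝ) * μ (I.cost pg) *
      (I.budget - I.cmax - I.listCost L) / I.cost pg
  have hknap : ∀ R ⊆ I.projs, ∀ θ, (∀ p ∈ R, θ ≤ I.projVal μ p) →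
      (∀ p ∈ I.projs, p ∉ R → I.projVal μ p ≤ θ) →
      W ≤ I.uw μ R + θ * (I.budget - I.cmax - I.costOf R) := by
    intro R hR θ h1 h2
    have := hdual θ
    rw [I.sum_max_projVal_sub hR h1 h2] at this
    linarith
  have hPM := I.completedMES_subset (μ := μ)
  have hκ1 := coeff_mul_le_one hb hm.le hcb
  have hfin : W ≤ I.uw μ (I.completedMES μ) → (2 * Real.sqrt (I.cmin / I.budget) -
      (I.cmax + I.cmin) / I.budget) * (I.budget / (I.budget - I.cmax)) * W ≤
      I.uw μ (I.completedMES μ) := (mul_le_of_le_one_left hW0 hκ1).trans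
  rcases I.completedMES_dichotomy hDNS with hQ | ⟨R, hRM, θ, h1, h2, h3⟩
  swap
  · exact hfin (by linarith [hknap R (hRM.trans hPM) θ h1 h2, I.uw_mono hμ hRM hPM])
  set τ := (I.voters.card : ℝ) * μ I.cmin / I.budget with hτ
  set Q := (I.completedMES μ).filter fun q => τ ≤ I.projVal μ q
  have hQM : Q ⊆ I.completedMES μ := Finset.filter_subset _ _
  obtain ⟨k, hk, hs, hcase⟩ := I.exists_equalShareState hμ
  have hSmes : I.projs \ (I.mesStateAux μ k).1 ⊆ I.mesOutcome μ :=
    Finset.sdiff_subset_sdiff subset_rfl (I.mesStateAux_fst_antitone hk)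
  have hSQ : I.projs \ (I.mesStateAux μ k).1 ⊆ Q := fun q hq => Finset.mem_filter.2
    ⟨Finset.mem_union_left _ (hSmes hq), I.le_projVal_of_mem_mesOutcome hDNS (hSmes hq)⟩
  have hSP := hSQ.trans (hQM.trans hPM)
  have hSX := I.uw_mono hμ (hSQ.trans hQM) hPM
  have hrem : ∀ p ∈ I.projs, p ∉ I.projs \ (I.mesStateAux μ k).1 →
      p ∈ (I.mesStateAux μ k).1 := by
    intro p hp hpn
    by_contra h
    exact hpn (Finset.mem_sdiff.2 ⟨hp, h⟩)
  rcases hcase with hzero | ⟨p, hp, hmax, i, hi, hlim⟩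
  · have := hknap _ hSP 0 (fun q hq => I.projVal_nonneg hμ (hSP hq))
      fun q hq hqn => hzero q (hrem q hq hqn)
    exact hfin (by linarith)
  have hpP := I.mesStateAux_fst_subset k hp
  have hvS : ∀ q ∈ I.projs \ (I.mesStateAux μ k).1, I.projVal μ p ≤ I.projVal μ q :=
    fun q hq => hs.1 q hq p hp
  have hW := hknap _ hSP _ hvS fun q hq hqn => hmax q (hrem q hq hqn)
  have hspend := hs.lt_costOf_add hDNS hpP hp hi hlim
  have hn : (0 : ℝ) < I.voters.card :=
    Nat.cast_pos.2 (Finset.card_pos.2 ⟨i, I.supp_subset_voters p hi⟩)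
  have hv : 0 < I.projVal μ p :=
    div_pos (I.card_supp_mul_pos hμ hpP ⟨i, hi⟩) (I.cost_pos p hpP)
  have hμm := hμ _ hm
  have hτ0 : 0 ≤ τ := by positivity
  have hQX := I.uw_mono hμ hQM hPM
  have hSQuw := I.uw_add_mul_le hSQ (hQM.trans hPM) fun q hq => (Finset.mem_filter.1 hq).2
  have hU := I.uw_add_mul_le (Finset.empty_subset _) hSP hvS
  simp only [PB.uw, PB.costOf, Finset.sum_empty, zero_add, sub_zero] at hU
  refine coeff_mul_le_of_spent (s := I.costOf (I.projs \ (I.mesStateAux μ k).1))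
    (v := I.projVal μ p) (w := I.projVal μ p * I.cmin / μ I.cmin / I.voters.card) (τ := τ)
    (U := I.uw μ (I.projs \ (I.mesStateAux μ k).1)) hb hm.le hcb hv (by positivity) ?_ ?_
    (I.uw_nonneg hμ hSP) ?_ hSX ?_ hW0 hW
  · rw [hτ]
    field_simp
  · refine (hspend.trans_eq' ?_).le
    ring
  · rw [mul_comm]
    exact hU
  · have := mul_le_mul_of_nonneg_left hQ hτ0
    linarith
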